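/- arXiv:1611.04663 — 5 statements merged into one kernel-verified Lean document; each statement's English description precedes it below -/
import Mathlib

section
/- Let q be a complex number with 0 < |q| < 1, let a be a nonzero complex number with a ∉ {q^m : m ∈ ℤ}, and let ξ be a complex number with 0 < |ξ| < 1 and ξ ∉ {−q^m : m ∈ ℤ}. Then the bilateral series ₁ψ₁(a; 0; q, −ξ) := Σ_{n∈ℤ} (a;q)_n (−ξ)^n converges and equals ((q;q)_∞/(q/a;q)_∞) · (θ_q(aξ)/θ_q(ξ)) · (−q/ξ; q)_∞. -/
open Complex Filter Topology

noncomputable def qPochInt (q a : ℂ) (n : ℤ) : ℂ :=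
  if 0 ≤ n then ∏ k ∈ Finset.range n.toNat, (1 - a * q ^ k)
  else (∏ k ∈ Finset.range (-n).toNat, (1 - a * q ^ (-(k + 1 : ℤ))))⁻¹

noncomputable def qPochInf (q a : ℂ) : ℂ := ∏' k : ℕ, (1 - a * q ^ k)

noncomputable def thetaQ (q z : ℂ) : ℂ := ∑' n : ℤ, q ^ (n * (n - 1) / 2) * z ^ n

theorem HasSum.congr_fun0 {f g : ℕ → ℂ} {s : ℂ} (hf : HasSum f s) (h : ∀ k, g k = f k) :
    HasSum g s := by
  rwa [funext h]

theorem tri_two (n : ℤ) : 2 * (n * (n - 1) / 2) = n * (n - 1) :=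
  Int.two_mul_ediv_two_of_even (Int.even_mul_pred_self n)

theorem tri_succ (n : ℤ) : (n + 1) * (n + 1 - 1) / 2 = n * (n - 1) / 2 + n := by
  have h1 := tri_two n
  have h2 := tri_two (n + 1)
  linarith

theorem tri_sub (n k : ℤ) : (n - k) * (n - k - 1) / 2 =
    n * (n - 1) / 2 + k * (k - 1) / 2 + k - n * k := by
  have h1 := tri_two n
  have h2 := tri_two (n - k)
  have h3 := tri_two k
  linarith

theorem tri_neg (n : ℤ) : (-n) * (-n - 1) / 2 = n * (n - 1) / 2 + n := by
  have h1 := tri_two n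
  have h2 := tri_two (-n)
  linarith

/-- The finite product `(q;q)_n`. -/
noncomputable def qfac (q : ℂ) (n : ℕ) : ℂ := ∏ k ∈ Finset.range n, (1 - q ^ (k + 1))

theorem one_sub_pow_ne {q : ℂ} (hq1 : ‖q‖ < 1) (k : ℕ) : 1 - q ^ (k + 1) ≠ 0 := by
  intro h
  have h2 : ‖q ^ (k + 1)‖ < 1 := by
    rw [norm_pow]; exact pow_lt_one₀ (norm_nonneg _) hq1 (by omega)
  rw [← sub_eq_zero.mp h] at h2
  simp at h2

theorem qfac_ne {q : ℂ} (hq1 : ‖q‖ < 1) (n : ℕ) : qfac q n ≠ 0 :=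
  Finset.prod_ne_zero_iff.mpr fun k _ => one_sub_pow_ne hq1 k

theorem qfac_succ (q : ℂ) (n : ℕ) : qfac q (n + 1) = qfac q n * (1 - q ^ (n + 1)) :=
  Finset.prod_range_succ _ _

theorem summ_geo {q : ℂ} (hq1 : ‖q‖ < 1) (x : ℂ) : Summable fun k : ℕ => ‖-(x * q ^ k)‖ := by
  simp only [norm_neg, norm_mul, norm_pow]
  exact (summable_geometric_of_lt_one (norm_nonneg _) hq1).mul_left _

theorem poch_mult {q : ℂ} (hq1 : ‖q‖ < 1) (x : ℂ) : Multipliable fun k : ℕ => (1 - x * q ^ k) := by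
  simpa [sub_eq_add_neg] using multipliable_one_add_of_summable (summ_geo hq1 x)

theorem poch_tendsto {q : ℂ} (hq1 : ‖q‖ < 1) (x : ℂ) :
    Tendsto (fun N => ∏ k ∈ Finset.range N, (1 - x * q ^ k)) atTop (𝓝 (qPochInf q x)) :=
  (poch_mult hq1 x).hasProd.tendsto_prod_nat

theorem poch_ne {q : ℂ} (hq1 : ‖q‖ < 1) (x : ℂ) (h : ∀ k : ℕ, 1 - x * q ^ k ≠ 0) :
    qPochInf q x ≠ 0 := by
  have := tprod_one_add_ne_zero_of_summable (f := fun k : ℕ => -(x * q ^ k))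
    (by simpa [sub_eq_add_neg] using h) (summ_geo hq1 x)
  simpa [qPochInf, sub_eq_add_neg] using this

theorem poch_step {q : ℂ} (hq1 : ‖q‖ < 1) (x : ℂ) :
    qPochInf q x = (1 - x) * qPochInf q (x * q) := by
  have h1 := (poch_tendsto hq1 x).comp (tendsto_add_atTop_nat 1)
  have h2 := (poch_tendsto hq1 (x * q)).const_mul (1 - x)
  refine tendsto_nhds_unique h1 (h2.congr fun N => ?_)
  simp only [Function.comp]
  rw [Finset.prod_range_succ']
  simp only [pow_zero, mul_one]
  rw [mul_comm]
  congr 1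
  exact Finset.prod_congr rfl fun k _ => by ring

theorem tendsto_den {q : ℂ} (hq1 : ‖q‖ < 1) :
    Tendsto (fun n : ℕ => 1 - q ^ (n + 1)) atTop (𝓝 1) := by
  have h := (tendsto_pow_atTop_nhds_zero_of_norm_lt_one hq1).comp (tendsto_add_atTop_nat 1)
  simpa using h.const_sub 1

theorem ratio_summ {f : ℕ → ℂ} {r : ℕ → ℂ} {l : ℂ} (hl : ‖l‖ < 1) (hf : ∀ n, f n ≠ 0)
    (h : ∀ n, f (n + 1) = f n * r n) (hr : Tendsto r atTop (𝓝 l)) : Summable f := by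
  refine summable_of_ratio_test_tendsto_lt_one hl (Eventually.of_forall hf) ?_
  refine hr.norm.congr fun n => ?_
  rw [h, norm_mul, mul_div_cancel_left₀]
  simpa using hf n

theorem E1_summ {q : ℂ} (hq1 : ‖q‖ < 1) {z : ℂ} (hz : ‖z‖ < 1) :
    Summable fun k : ℕ => z ^ k / qfac q k := by
  by_cases h0 : z = 0
  · subst h0
    refine summable_of_ne_finset_zero (s := {0}) fun b hb => ?_
    simp at hb; simp [hb]
  refine ratio_summ (r := fun n => z / (1 - q ^ (n + 1))) (l := z / 1) (by simpa using hz)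
    (fun n => div_ne_zero (pow_ne_zero _ h0) (qfac_ne hq1 n)) (fun n => ?_)
    (tendsto_const_nhds.div (tendsto_den hq1) one_ne_zero)
  rw [qfac_succ, pow_succ]
  have := qfac_ne hq1 n
  have := one_sub_pow_ne hq1 n
  field_simp

/-- Coefficients of `(x;q)_∞`. -/
noncomputable def ecoef (q : ℂ) (k : ℕ) : ℂ := (-1) ^ k * q ^ ((k : ℤ) * (k - 1) / 2) / qfac q k

theorem ecoef_succ {q : ℂ} (hq0 : q ≠ 0) (n : ℕ) :
    ecoef q (n + 1) = ecoef q n * (-(q ^ n / (1 - q ^ (n + 1)))) := by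
  unfold ecoef
  push_cast
  rw [tri_succ, qfac_succ, zpow_add₀ hq0, pow_succ, zpow_natCast]
  simp only [div_eq_mul_inv, mul_inv]
  ring

theorem E2_summ {q : ℂ} (hq0 : q ≠ 0) (hq1 : ‖q‖ < 1) (x : ℂ) :
    Summable fun k : ℕ => ecoef q k * x ^ k := by
  by_cases h0 : x = 0
  · subst h0
    refine summable_of_ne_finset_zero (s := {0}) fun b hb => ?_
    simp at hb; simp [hb]
  refine ratio_summ (r := fun n => -(q ^ n / (1 - q ^ (n + 1))) * x) (l := -(0 / 1) * x) (by simp)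
    (fun n => mul_ne_zero ?_ (pow_ne_zero _ h0)) (fun n => ?_)
    ((((tendsto_pow_atTop_nhds_zero_of_norm_lt_one hq1).div (tendsto_den hq1)
      one_ne_zero).neg).mul_const x)
  · unfold ecoef
    exact div_ne_zero (mul_ne_zero (by simp) (zpow_ne_zero _ hq0)) (qfac_ne hq1 n)
  · rw [ecoef_succ hq0]; ring

theorem tendsto_series {q : ℂ} (hq1 : ‖q‖ < 1) (c : ℕ → ℂ) (x : ℂ)
    (hs : Summable fun k => c k * x ^ k) :
    Tendsto (fun N : ℕ => ∑' k, c k * (x * q ^ N) ^ k) atTop (𝓝 (c 0)) := by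
  have h0 : c 0 = ∑' k, c k * (0 : ℂ) ^ k := by
    rw [tsum_eq_single 0]
    · simp
    · intro b hb; simp [hb]
  rw [h0]
  refine tendsto_tsum_of_dominated_convergence hs.norm (fun k => ?_)
    (Eventually.of_forall fun N k => ?_)
  · have : Tendsto (fun N : ℕ => x * q ^ N) atTop (𝓝 0) := by
      simpa using (tendsto_pow_atTop_nhds_zero_of_norm_lt_one hq1).const_mul x
    exact (this.pow k).const_mul _
  · rw [norm_mul, norm_mul, norm_pow, norm_pow, norm_mul, norm_pow]
    gcongr
    exact mul_le_of_le_one_right (norm_nonneg _) (pow_le_one₀ (norm_nonneg _) hq1.le)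

theorem E2 {q : ℂ} (hq0 : q ≠ 0) (hq1 : ‖q‖ < 1) (x : ℂ) :
    HasSum (fun k : ℕ => ecoef q k * x ^ k) (qPochInf q x) := by
  have step : ∀ x : ℂ, ∑' k, ecoef q k * x ^ k = (1 - x) * ∑' k, ecoef q k * (x * q) ^ k := by
    intro x
    have s1 := E2_summ hq0 hq1 x
    have s2 := E2_summ hq0 hq1 (x * q)
    have h1 : ∑' k, (ecoef q k * x ^ k - ecoef q k * (x * q) ^ k)
        = ∑' k, -x * (ecoef q k * (x * q) ^ k) := by
      rw [(s1.sub s2).tsum_eq_zero_add]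
      simp only [pow_zero, sub_self, zero_add]
      refine tsum_congr fun k => ?_
      rw [ecoef_succ hq0]
      have := one_sub_pow_ne hq1 k
      rw [mul_pow, mul_pow]
      field_simp
      ring
    rw [s1.tsum_sub s2, tsum_mul_left] at h1
    linear_combination h1
  have iter : ∀ N : ℕ, ∑' k, ecoef q k * x ^ k =
      (∏ k ∈ Finset.range N, (1 - x * q ^ k)) * ∑' k, ecoef q k * (x * q ^ N) ^ k := by
    intro N
    induction N with
    | zero => simp
    | succ N ih => rw [ih, step (x * q ^ N), Finset.prod_range_succ, pow_succ]; ring_nf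
  have h := (poch_tendsto hq1 x).mul (tendsto_series hq1 _ x (E2_summ hq0 hq1 x))
  have e0 : ecoef q 0 = 1 := by simp [ecoef, qfac]
  rw [e0, mul_one] at h
  have := tendsto_nhds_unique (tendsto_const_nhds.congr iter) h
  rw [← this]
  exact (E2_summ hq0 hq1 x).hasSum

theorem E1 {q : ℂ} (hq1 : ‖q‖ < 1) {z : ℂ} (hz : ‖z‖ < 1) :
    (∑' k : ℕ, z ^ k / qfac q k) * qPochInf q z = 1 := by
  have step : ∀ x : ℂ, ‖x‖ < 1 → (∑' k : ℕ, x ^ k / qfac q k) * (1 - x) =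
      ∑' k : ℕ, (x * q) ^ k / qfac q k := by
    intro x hx
    have hxq : ‖x * q‖ < 1 := by
      rw [norm_mul]; exact mul_lt_one_of_nonneg_of_lt_one_left (norm_nonneg _) hx hq1.le
    have s1 := E1_summ hq1 hx
    have s2 := E1_summ hq1 hxq
    have h1 : ∑' k, (x ^ k / qfac q k - (x * q) ^ k / qfac q k)
        = ∑' k : ℕ, x * (x ^ k / qfac q k) := by
      rw [(s1.sub s2).tsum_eq_zero_add]
      simp only [pow_zero, sub_self, zero_add]
      refine tsum_congr fun k => ?_
      rw [qfac_succ]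
      have := one_sub_pow_ne hq1 k
      have := qfac_ne hq1 k
      rw [mul_pow]
      field_simp
      try ring
    rw [s1.tsum_sub s2, tsum_mul_left] at h1
    linear_combination h1
  have iter : ∀ N : ℕ, (∑' k : ℕ, z ^ k / qfac q k) * (∏ k ∈ Finset.range N, (1 - z * q ^ k)) =
      ∑' k : ℕ, (z * q ^ N) ^ k / qfac q k := by
    intro N
    induction N with
    | zero => simp
    | succ N ih =>
      have hN : ‖z * q ^ N‖ < 1 := by
        rw [norm_mul, norm_pow]
        exact mul_lt_one_of_nonneg_of_lt_one_left (norm_nonneg _) hz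
          (pow_le_one₀ (norm_nonneg _) hq1.le)
      rw [Finset.prod_range_succ, ← mul_assoc, ih, step _ hN, pow_succ, mul_assoc]
  have s := E1_summ hq1 hz
  have h := tendsto_series hq1 (fun k => (qfac q k)⁻¹) z (by simpa [div_eq_inv_mul] using s)
  have h2 := ((poch_tendsto hq1 z).const_mul (∑' k : ℕ, z ^ k / qfac q k)).congr iter
  simp only [div_eq_inv_mul] at h2 ⊢
  simpa [qfac] using tendsto_nhds_unique h2 h

theorem theta_summ {q : ℂ} (hq0 : q ≠ 0) (hq1 : ‖q‖ < 1) {z : ℂ} (hz : z ≠ 0) :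
    Summable fun n : ℤ => q ^ (n * (n - 1) / 2) * z ^ n := by
  have hp := tendsto_pow_atTop_nhds_zero_of_norm_lt_one hq1
  refine Summable.of_nat_of_neg ?_ ?_
  · refine ratio_summ (r := fun n => q ^ n * z) (l := 0 * z) (by simp)
      (fun n => mul_ne_zero (zpow_ne_zero _ hq0) (zpow_ne_zero _ hz)) (fun n => ?_)
      (hp.mul_const z)
    push_cast
    rw [tri_succ, zpow_add₀ hq0, zpow_add_one₀ hz, zpow_natCast]
    ring
  · refine ratio_summ (r := fun n => q ^ (n + 1) * z⁻¹) (l := 0 * z⁻¹) (by simp)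
      (fun n => mul_ne_zero (zpow_ne_zero _ hq0) (zpow_ne_zero _ hz)) (fun n => ?_)
      ((hp.comp (tendsto_add_atTop_nat 1)).mul_const z⁻¹)
    have e : (-((n : ℤ) + 1)) * (-((n : ℤ) + 1) - 1) / 2 =
        (-(n : ℤ)) * (-(n : ℤ) - 1) / 2 + ((n + 1 : ℕ) : ℤ) := by
      rw [tri_neg, tri_neg, tri_succ]; push_cast; ring
    rw [Nat.cast_add, Nat.cast_one, e, zpow_add₀ hq0, zpow_natCast, neg_add, zpow_add₀ hz, zpow_neg_one]
    ring

/-- The shear `(n, k) ↦ (n - k, k)`. -/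
def shear : ℤ × ℕ ≃ ℤ × ℕ where
  toFun := fun p => (p.1 - p.2, p.2)
  invFun := fun p => (p.1 + p.2, p.2)
  left_inv := fun p => by simp
  right_inv := fun p => by simp

theorem key_term {q : ℂ} (hq0 : q ≠ 0) {a z : ℂ} (ha : a ≠ 0) (hz0 : z ≠ 0) (n : ℤ) (k : ℕ) :
    q ^ ((n - k) * (n - k - 1) / 2) * (-(a * z)) ^ (n - k) * (z ^ k / qfac q k) =
    ((-a) ^ n * q ^ (n * (n - 1) / 2) * z ^ n) * (ecoef q k * (q ^ (1 - n) / a) ^ k) := by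
  have hna : -a ≠ 0 := neg_ne_zero.mpr ha
  have e1 : (q ^ (1 - n)) ^ k = q ^ ((k : ℤ) - n * k) := by
    rw [← zpow_natCast, ← zpow_mul]; congr 1; ring
  have h2 : ((-1 : ℂ) ^ k)⁻¹ = (-1) ^ k := by rw [← inv_pow]; simp
  rw [tri_sub, ← neg_mul, mul_zpow, zpow_sub₀ hna, zpow_sub₀ hz0, zpow_natCast, zpow_natCast,
    div_pow, e1, ecoef, add_sub_assoc, zpow_add₀ hq0, zpow_add₀ hq0, neg_pow a k]
  have hzk : z ^ k * (z ^ k)⁻¹ = 1 := mul_inv_cancel₀ (pow_ne_zero _ hz0)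
  simp only [div_eq_mul_inv, mul_inv, h2]
  generalize z ^ k = Z at *
  generalize (z ^ n) = Y
  generalize q ^ (n * (n - 1) / 2) = A
  generalize q ^ ((k : ℤ) * (k - 1) / 2) = B
  generalize q ^ ((k : ℤ) - n * k) = C
  linear_combination (A * B * C * (-a) ^ n * (-1) ^ k * (a ^ k)⁻¹ * Y * (qfac q k)⁻¹) * hzk

theorem shear_hasSum {f : ℤ → ℂ} {g : ℕ → ℂ} (hf : Summable f) (hg : Summable g) :
    HasSum ((fun p : ℤ × ℕ => f p.1 * g p.2) ∘ shear) ((∑' n, f n) * ∑' k, g k) := by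
  have s3 : Summable (fun p : ℤ × ℕ => f p.1 * g p.2) :=
    summable_mul_of_summable_norm hf.norm hg.norm
  exact (Equiv.hasSum_iff shear).mpr (hf.hasSum.mul hg.hasSum s3)

theorem key {q : ℂ} (hq0 : q ≠ 0) (hq1 : ‖q‖ < 1) {a z : ℂ} (ha : a ≠ 0) (hz0 : z ≠ 0)
    (hz : ‖z‖ < 1) :
    HasSum (fun n : ℤ => ((-a) ^ n * q ^ (n * (n - 1) / 2) * qPochInf q (q ^ (1 - n) / a)) * z ^ n)
      (thetaQ q (-(a * z)) * (∑' k : ℕ, z ^ k / qfac q k)) := by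
  have haz : -(a * z) ≠ 0 := neg_ne_zero.mpr (mul_ne_zero ha hz0)
  have s1 := theta_summ hq0 hq1 haz
  have s2 := E1_summ hq1 hz
  have h' := shear_hasSum s1 s2
  have hf : ∀ n : ℤ, HasSum (fun k : ℕ => ((fun p : ℤ × ℕ => q ^ (p.1 * (p.1 - 1) / 2) *
      (-(a * z)) ^ p.1 * (z ^ p.2 / qfac q p.2)) ∘ shear) (n, k))
      (((-a) ^ n * q ^ (n * (n - 1) / 2) * qPochInf q (q ^ (1 - n) / a)) * z ^ n) := by
    intro n
    have hE := (E2 hq0 hq1 (q ^ (1 - n) / a)).mul_left ((-a) ^ n * q ^ (n * (n - 1) / 2) * z ^ n)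
    rw [mul_right_comm]
    exact HasSum.congr_fun0 hE fun k => key_term hq0 ha hz0 n k
  exact HasSum.prod_fiberwise h' hf

theorem jtp {q : ℂ} (hq0 : q ≠ 0) (hq1 : ‖q‖ < 1) {z : ℂ} (hz0 : z ≠ 0) (hz : ‖z‖ < 1) :
    thetaQ q (-z) * (∑' k : ℕ, z ^ k / qfac q k) = qPochInf q q * qPochInf q (q / z) := by
  have h := key hq0 hq1 (one_ne_zero) hz0 hz
  rw [one_mul] at h
  have hinj : Function.Injective (fun m : ℕ => -(m : ℤ)) := fun a b h => by simpa using h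
  have hsh : ∀ m : ℕ, qPochInf q q = qfac q m * qPochInf q (q ^ (m + 1)) := by
    intro m
    induction m with
    | zero => simp [qfac]
    | succ m ih => rw [ih, poch_step hq1 (q ^ (m + 1)), qfac_succ, pow_succ q (m + 1)]; ring
  rw [← hinj.hasSum_iff] at h
  · refine h.unique ?_
    refine HasSum.congr_fun0 ((E2 hq0 hq1 (q / z)).mul_left (qPochInf q q)) ?_
    intro m
    simp only [Function.comp]
    have e1 : q ^ (1 - -(m : ℤ)) = q ^ (m + 1) := by
      rw [← zpow_natCast]; congr 1; push_cast; ring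
    rw [tri_neg, e1, div_one, hsh m, zpow_add₀ hq0, ecoef, zpow_neg, zpow_neg, zpow_natCast,
      zpow_natCast, zpow_natCast, div_pow]
    have := qfac_ne hq1 m
    have h2 : ((-1 : ℂ) ^ m)⁻¹ = (-1) ^ m := by rw [← inv_pow]; simp
    rw [h2]
    field_simp
  · intro n hn
    have hpos : 0 < n := by
      by_contra hc
      exact hn ⟨(-n).toNat, by simp only; omega⟩
    obtain ⟨m, rfl⟩ : ∃ m : ℕ, n = m + 1 := ⟨(n - 1).toNat, by omega⟩
    have : qPochInf q (q ^ (1 - ((m : ℤ) + 1)) / 1) = 0 := by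
      unfold qPochInf
      refine tprod_of_exists_eq_zero ⟨m, ?_⟩
      rw [div_one, ← zpow_natCast, ← zpow_add₀ hq0]
      simp
    rw [this]; simp

theorem poch_int_succ {q a : ℂ} (haq : ∀ m : ℤ, a ≠ q ^ m) (hq0 : q ≠ 0) (n : ℤ) :
    qPochInt q a (n + 1) = (1 - a * q ^ n) * qPochInt q a n := by
  rcases n with m | m
  · have h1 : (0 : ℤ) ≤ (m : ℤ) + 1 := by omega
    have h2 : (0 : ℤ) ≤ (m : ℤ) := by omega
    have h3 : ((m : ℤ) + 1).toNat = m + 1 := by omega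
    simp only [Int.ofNat_eq_natCast, qPochInt, h1, h2, if_true, h3, Int.toNat_natCast, Finset.prod_range_succ, zpow_natCast]
    ring
  · have hs : Int.negSucc m = -((m : ℤ) + 1) := by omega
    have hne : 1 - a * q ^ (-((m : ℤ) + 1)) ≠ 0 := by
      intro h
      apply haq (m + 1)
      rw [zpow_neg] at h
      have := zpow_ne_zero ((m : ℤ) + 1) hq0
      field_simp at h
      linear_combination -h
    have h2 : ¬ (0 : ℤ) ≤ -((m : ℤ) + 1) := by omega
    have h3 : (-(-((m : ℤ) + 1))).toNat = m + 1 := by omega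
    have h4 : qPochInt q a (-((m : ℤ) + 1)) =
        (∏ k ∈ Finset.range m, (1 - a * q ^ (-(k + 1 : ℤ))))⁻¹ * (1 - a * q ^ (-((m : ℤ) + 1)))⁻¹ := by
      rw [qPochInt, if_neg h2, h3, Finset.prod_range_succ, mul_inv]
    rw [hs, h4]
    have h5 : -((m : ℤ) + 1) + 1 = -m := by ring
    rw [h5]
    have h6 : qPochInt q a (-(m : ℤ)) = (∏ k ∈ Finset.range m, (1 - a * q ^ (-(k + 1 : ℤ))))⁻¹ := by
      rcases Nat.eq_zero_or_pos m with h | h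
      · subst h; simp [qPochInt]
      · rw [qPochInt, if_neg (by omega)]; simp
    rw [h6, mul_comm, mul_assoc, inv_mul_cancel₀ hne, mul_one]

theorem poch_rel {q a : ℂ} (haq : ∀ m : ℤ, a ≠ q ^ m) (ha : a ≠ 0) (hq0 : q ≠ 0) (hq1 : ‖q‖ < 1)
    (n : ℤ) : qPochInt q a n * qPochInf q (q / a) =
      (-a) ^ n * q ^ (n * (n - 1) / 2) * qPochInf q (q ^ (1 - n) / a) := by
  have hna : -a ≠ 0 := neg_ne_zero.mpr ha
  have step : ∀ n : ℤ, (-a) ^ (n + 1) * q ^ ((n + 1) * (n + 1 - 1) / 2) *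
      qPochInf q (q ^ (1 - (n + 1)) / a) = (1 - a * q ^ n) *
      ((-a) ^ n * q ^ (n * (n - 1) / 2) * qPochInf q (q ^ (1 - n) / a)) := by
    intro n
    have e : q ^ (1 - (n + 1)) / a * q = q ^ (1 - n) / a := by
      rw [div_mul_eq_mul_div, ← zpow_add_one₀ hq0]; congr 2; ring
    have e2 : q ^ (1 - (n + 1)) = (q ^ n)⁻¹ := by rw [← zpow_neg]; congr 1; ring
    rw [poch_step hq1 (q ^ (1 - (n + 1)) / a), e, tri_succ, zpow_add₀ hq0, zpow_add_one₀ hna, e2]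
    have := zpow_ne_zero n hq0
    field_simp
    ring
  induction n using Int.induction_on with
  | zero => simp [qPochInt]
  | succ n ih => rw [step, poch_int_succ haq hq0, ← ih]; ring
  | pred n ih =>
    have h1 := step (-(n : ℤ) - 1)
    have h2 := poch_int_succ haq hq0 (-(n : ℤ) - 1)
    rw [sub_add_cancel] at h1 h2
    rw [h1, h2, mul_assoc] at ih
    refine mul_left_cancel₀ ?_ ih
    intro h
    apply haq (-(-(n : ℤ) - 1))
    rw [zpow_neg]
    exact eq_inv_of_mul_eq_one_left (sub_eq_zero.mp h).symm

theorem stmt_6 (q a ξ : ℂ)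
    (hq0 : 0 < ‖q‖) (hq1 : ‖q‖ < 1)
    (ha : a ≠ 0) (haq : ∀ m : ℤ, a ≠ q ^ m)
    (hξ0 : 0 < ‖ξ‖) (hξ1 : ‖ξ‖ < 1)
    (hξq : ∀ m : ℤ, ξ ≠ -(q ^ m)) :
    HasSum (fun n : ℤ => qPochInt q a n * (-ξ) ^ n)
      ((qPochInf q q / qPochInf q (q / a)) * (thetaQ q (a * ξ) / thetaQ q ξ) *
        qPochInf q (-(q / ξ))) := by
  have hq : q ≠ 0 := norm_pos_iff.mp hq0
  have hξ : ξ ≠ 0 := norm_pos_iff.mp hξ0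
  have hz0 : -ξ ≠ 0 := neg_ne_zero.mpr hξ
  have hz : ‖-ξ‖ < 1 := by simpa using hξ1
  have hk := key hq hq1 ha hz0 hz
  have hj := jtp hq hq1 hz0 hz
  have hE := E1 hq1 hz
  have nqa : qPochInf q (q / a) ≠ 0 := by
    refine poch_ne hq1 _ fun k h => haq (k + 1) ?_
    rw [zpow_add_one₀ hq, zpow_natCast]
    field_simp at h
    linear_combination h
  have nqq : qPochInf q q ≠ 0 := by
    refine poch_ne hq1 _ fun k => ?_
    have := one_sub_pow_ne hq1 k
    rwa [pow_succ, mul_comm] at this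
  have nqx : qPochInf q (-(q / ξ)) ≠ 0 := by
    refine poch_ne hq1 _ fun k h => hξq (k + 1) ?_
    rw [zpow_add_one₀ hq, zpow_natCast]
    field_simp at h
    linear_combination h
  have e : (-(a * -ξ)) = a * ξ := by ring
  rw [e] at hk
  rw [neg_neg, div_neg] at hj
  have hth : thetaQ q ξ ≠ 0 := by
    intro h
    rw [h, zero_mul] at hj
    exact mul_ne_zero nqq nqx hj.symm
  have hfin := hk.div_const (qPochInf q (q / a))
  have e1 : (fun n : ℤ => qPochInt q a n * (-ξ) ^ n) = fun n : ℤ => (-a) ^ n *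
      q ^ (n * (n - 1) / 2) * qPochInf q (q ^ (1 - n) / a) * (-ξ) ^ n / qPochInf q (q / a) := by
    funext n
    rw [← poch_rel haq ha hq hq1 n]
    field_simp
  have e2 : (qPochInf q q / qPochInf q (q / a)) * (thetaQ q (a * ξ) / thetaQ q ξ) *
      qPochInf q (-(q / ξ)) =
      (thetaQ q (a * ξ) * ∑' k : ℕ, (-ξ) ^ k / qfac q k) / qPochInf q (q / a) := by
    generalize (∑' k : ℕ, (-ξ) ^ k / qfac q k) = S at *
    generalize qPochInf q (-(q / ξ)) = X at *
    generalize qPochInf q (q / a) = Y at *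
    field_simp
    linear_combination (-thetaQ q (a * ξ)) * hj
  rw [e1, e2]
  exact hfin
end

section
/- Let q be a complex number with 0 < |q| < 1, let a be a nonzero complex number with a ∉ {q^m : m ∈ ℤ}, let λ be a nonzero complex number with λ ∉ {−q^m : m ∈ ℤ}, and let x be a nonzero complex number with |ax| > 1 and x ∉ {−λ q^m : m ∈ ℤ}. Define ψ_B(ξ) := ((q;q)_∞/(q/a;q)_∞) · (θ_q(aξ)/θ_q(ξ)) · (−q/ξ; q)_∞ for ξ ∈ ℂ* with θ_q(ξ) ≠ 0. Then Σ_{n∈ℤ} [ ψ_B(λq^n) / θ_q(λq^n/x) ] = ((q;q)_∞/(q/a;q)_∞) · [ θ_q(aλ) θ_q(aqx/λ) / ( θ_q(λ) θ_q(qx/λ) ) ] · ₁φ₀(0; −; q, 1/(ax)), where ₁φ₀(0;−;q,z) := Σ_{m≥0} z^m/(q;q)_m, and the left-hand side converges absolutely. -/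
open Complex Filter Topology

lemma aux_exp (m k : ℤ) :
    (m + k) * (m + k - 1) / 2 = m * (m - 1) / 2 + k * (k - 1) / 2 + m * k := by
  obtain ⟨u, hu⟩ := Int.even_mul_pred_self m
  obtain ⟨v, hv⟩ := Int.even_mul_pred_self k
  have h : (m + k) * (m + k - 1) = 2 * (u + v + m * k) := by linear_combination hu + hv
  rw [h, hu, hv]
  omega

lemma aux_t_add {q : ℂ} (hq : q ≠ 0) (m k : ℤ) :
    q ^ ((m + k) * (m + k - 1) / 2) =
      q ^ (m * (m - 1) / 2) * q ^ (k * (k - 1) / 2) * q ^ (m * k) := by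
  rw [aux_exp, zpow_add₀ hq, zpow_add₀ hq]

lemma aux_t_succ {q : ℂ} (hq : q ≠ 0) (m : ℤ) :
    q ^ ((m + 1) * (m + 1 - 1) / 2) = q ^ (m * (m - 1) / 2) * q ^ m := by
  rw [aux_t_add hq]; simp

lemma aux_theta_summable {q z : ℂ} (hq : q ≠ 0) (hq1 : ‖q‖ < 1) (hz : z ≠ 0) :
    Summable (fun n : ℤ => q ^ (n * (n - 1) / 2) * z ^ n) := by
  have hlim : ∀ c : ℝ, Tendsto (fun n : ℕ => ‖q‖ ^ n * c) atTop (𝓝 0) := fun c => by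
    simpa using (tendsto_pow_atTop_nhds_zero_of_lt_one (norm_nonneg q) hq1).mul_const c
  apply Summable.of_nat_of_neg
  · apply summable_of_ratio_test_tendsto_lt_one (l := 0) zero_lt_one
    · exact Eventually.of_forall fun n => mul_ne_zero (zpow_ne_zero _ hq) (zpow_ne_zero _ hz)
    · refine (hlim ‖z‖).congr fun n => ?_
      rw [← norm_div, ← norm_pow, ← norm_mul]
      congr 1
      push_cast
      rw [aux_t_succ hq, zpow_add_one₀ hz]
      have h1 := zpow_ne_zero ((n : ℤ) * (n - 1) / 2) hq
      have h2 := zpow_ne_zero (n : ℤ) hz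
      rw [zpow_natCast q n]
      field_simp
  · apply summable_of_ratio_test_tendsto_lt_one (l := 0) zero_lt_one
    · exact Eventually.of_forall fun n => mul_ne_zero (zpow_ne_zero _ hq) (zpow_ne_zero _ hz)
    · refine (hlim ‖q * z⁻¹‖).congr fun n => ?_
      rw [← norm_div, ← norm_pow, ← norm_mul]
      congr 1
      push_cast
      have h := aux_t_succ hq (-((n : ℤ) + 1))
      have h' := zpow_add_one₀ hz (-((n : ℤ) + 1))
      have e : -((n : ℤ) + 1) + 1 = -n := by ring
      rw [e] at h h'
      rw [h, h']
      have h1 := zpow_ne_zero (-((n : ℤ) + 1) * (-((n : ℤ) + 1) - 1) / 2) hq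
      have h2 := zpow_ne_zero (-((n : ℤ) + 1)) hz
      have h3 : q ^ (-((n : ℤ) + 1)) = (q ^ n * q)⁻¹ := by
        rw [zpow_neg, zpow_add_one₀ hq, zpow_natCast]
      rw [h3]
      field_simp

/-- finite (q;q)_k -/
noncomputable def auxP (q : ℂ) (k : ℕ) : ℂ := ∏ i ∈ Finset.range k, (1 - q * q ^ i)

lemma auxP_factor {q : ℂ} (hq1 : ‖q‖ < 1) (i : ℕ) : 1 - q * q ^ i ≠ 0 := by
  intro h
  have h1 : q ^ (i + 1) = 1 := by rw [pow_succ']; linear_combination -h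
  have h2 : ‖q‖ ^ (i + 1) < 1 := pow_lt_one₀ (norm_nonneg _) hq1 (by omega)
  rw [← norm_pow, h1] at h2
  simp at h2

lemma auxP_ne {q : ℂ} (hq1 : ‖q‖ < 1) (k : ℕ) : auxP q k ≠ 0 :=
  Finset.prod_ne_zero_iff.2 fun i _ => auxP_factor hq1 i

lemma auxP_succ (q : ℂ) (k : ℕ) : auxP q (k + 1) = auxP q k * (1 - q * q ^ k) :=
  Finset.prod_range_succ _ _

lemma aux_lim {q : ℂ} (hq1 : ‖q‖ < 1) :
    Tendsto (fun n : ℕ => 1 - q * q ^ n) atTop (𝓝 1) := by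
  simpa using ((tendsto_pow_atTop_nhds_zero_of_norm_lt_one hq1).const_mul q).const_sub 1

lemma aux_phi_summable {q z : ℂ} (hq1 : ‖q‖ < 1) (hz : z ≠ 0) (hz1 : ‖z‖ < 1) :
    Summable (fun k : ℕ => z ^ k / auxP q k) := by
  apply summable_of_ratio_test_tendsto_lt_one (l := ‖z‖) hz1
  · exact Eventually.of_forall fun n => div_ne_zero (pow_ne_zero _ hz) (auxP_ne hq1 n)
  · have h : Tendsto (fun n : ℕ => ‖z / (1 - q * q ^ n)‖) atTop (𝓝 ‖z / 1‖) :=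
      ((tendsto_const_nhds (x := z)).div (aux_lim hq1) one_ne_zero).norm
    rw [div_one] at h
    refine h.congr fun n => ?_
    rw [← norm_div]
    congr 1
    rw [auxP_succ, pow_succ]
    have h1 := auxP_ne hq1 n
    have h2 := auxP_factor hq1 n
    have h3 := pow_ne_zero n hz
    field_simp

lemma aux_euler_summable {q w : ℂ} (hq : q ≠ 0) (hq1 : ‖q‖ < 1) (hw : w ≠ 0) :
    Summable (fun k : ℕ => q ^ ((k : ℤ) * (k - 1) / 2) * w ^ k / auxP q k) := by
  apply summable_of_ratio_test_tendsto_lt_one (l := 0) zero_lt_one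
  · exact Eventually.of_forall fun n =>
      div_ne_zero (mul_ne_zero (zpow_ne_zero _ hq) (pow_ne_zero _ hw)) (auxP_ne hq1 n)
  · have h : Tendsto (fun n : ℕ => ‖q ^ n * w / (1 - q * q ^ n)‖) atTop (𝓝 ‖0 * w / 1‖) :=
      (((tendsto_pow_atTop_nhds_zero_of_norm_lt_one hq1).mul_const w).div
        (aux_lim hq1) one_ne_zero).norm
    rw [zero_mul, zero_div, norm_zero] at h
    refine h.congr fun n => ?_
    rw [← norm_div]
    congr 1
    push_cast
    rw [auxP_succ, pow_succ, aux_t_succ hq, zpow_natCast q n]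
    have h1 := auxP_ne hq1 n
    have h2 := auxP_factor hq1 n
    have h3 := pow_ne_zero n hw
    have h4 := zpow_ne_zero ((n : ℤ) * (n - 1) / 2) hq
    field_simp

noncomputable def auxF (q w : ℂ) : ℂ :=
  ∑' k : ℕ, q ^ ((k : ℤ) * (k - 1) / 2) * w ^ k / auxP q k

lemma auxF_rec {q w : ℂ} (hq : q ≠ 0) (hq1 : ‖q‖ < 1) (hw : w ≠ 0) :
    auxF q w = (1 + w) * auxF q (w * q) := by
  have s1 := aux_euler_summable hq hq1 hw
  have s2 := aux_euler_summable hq hq1 (mul_ne_zero hw hq)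
  have h : auxF q w - auxF q (w * q) = w * auxF q (w * q) := by
    unfold auxF
    rw [← s1.tsum_sub s2, (s1.sub s2).tsum_eq_zero_add, ← tsum_mul_left]
    simp only [pow_zero, sub_self, zero_add]
    refine tsum_congr fun k => ?_
    push_cast
    rw [auxP_succ, aux_t_succ hq, zpow_natCast q k]
    have h1 := auxP_ne hq1 k
    have h2 := auxP_factor hq1 k
    rw [← sub_div, mul_div_assoc', div_eq_div_iff (mul_ne_zero h1 h2) h1]
    ring
  linear_combination h

lemma auxF_iter {q w : ℂ} (hq : q ≠ 0) (hq1 : ‖q‖ < 1) (hw : w ≠ 0) (N : ℕ) :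
    auxF q w = (∏ k ∈ Finset.range N, (1 + w * q ^ k)) * auxF q (w * q ^ N) := by
  induction N with
  | zero => simp
  | succ N ih =>
    rw [ih, auxF_rec hq hq1 (mul_ne_zero hw (pow_ne_zero N hq)), Finset.prod_range_succ, pow_succ]
    ring_nf

lemma auxF_lim {q w : ℂ} (hq : q ≠ 0) (hq1 : ‖q‖ < 1) (hw : w ≠ 0) :
    Tendsto (fun N : ℕ => auxF q (w * q ^ N)) atTop (𝓝 1) := by
  have s1 := aux_euler_summable hq hq1 hw
  have e : (∑' k : ℕ, if k = 0 then (1 : ℂ) else 0) = 1 := by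
    rw [tsum_ite_eq]
  rw [← e]
  unfold auxF
  refine tendsto_tsum_of_dominated_convergence s1.norm ?_ ?_
  · intro k
    rcases Nat.eq_zero_or_pos k with rfl | hk
    · simp [auxP]
    · rw [if_neg hk.ne']
      have h : Tendsto (fun N : ℕ => w * q ^ N) atTop (𝓝 (w * 0)) :=
        (tendsto_pow_atTop_nhds_zero_of_norm_lt_one hq1).const_mul w
      have h' := ((h.pow k).const_mul (q ^ ((k : ℤ) * (k - 1) / 2))).div_const (auxP q k)
      simpa [hk.ne'] using h'
  · refine Eventually.of_forall fun N k => ?_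
    rw [norm_div, norm_div, norm_mul, norm_mul]
    gcongr
    rw [norm_pow, norm_pow, norm_mul, norm_pow]
    gcongr
    exact mul_le_of_le_one_right (norm_nonneg _) (pow_le_one₀ (norm_nonneg _) hq1.le)

lemma aux_euler {q w : ℂ} (hq : q ≠ 0) (hq1 : ‖q‖ < 1) (hw : w ≠ 0) :
    auxF q w = qPochInf q (-w) := by
  have hm : Multipliable (fun k : ℕ => 1 + w * q ^ k) := by
    apply Complex.multipliable_one_add_of_summable
    exact (summable_geometric_of_norm_lt_one hq1).mul_left w
  have h := (hm.hasProd.tendsto_prod_nat).mul (auxF_lim hq hq1 hw)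
  have h2 : Tendsto (fun _ : ℕ => auxF q w) atTop (𝓝 (auxF q w)) := tendsto_const_nhds
  have := tendsto_nhds_unique (h2.congr fun N => auxF_iter hq hq1 hw N) h
  rw [this, mul_one]
  unfold qPochInf
  exact tprod_congr fun k => by ring

lemma aux_theta_inv {q z : ℂ} (hq : q ≠ 0) (hz : z ≠ 0) :
    thetaQ q (q / z) = thetaQ q z := by
  unfold thetaQ
  rw [← (Equiv.neg ℤ).tsum_eq]
  refine tsum_congr fun n => ?_
  have h := aux_exp (-n) 1
  have e : n * (n - 1) / 2 = -n * (-n - 1) / 2 + -n := by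
    have : (-n + 1) * (-n + 1 - 1) = n * (n - 1) := by ring
    rw [this] at h
    simpa using h
  rw [e, zpow_add₀ hq, Equiv.neg_apply, div_zpow, zpow_neg z, div_inv_eq_mul]
  ring

lemma aux_theta_shift_one {q z : ℂ} (hq : q ≠ 0) (hz : z ≠ 0) :
    thetaQ q z = z * thetaQ q (z * q) := by
  unfold thetaQ
  rw [← (Equiv.addRight (1 : ℤ)).tsum_eq, ← tsum_mul_left]
  refine tsum_congr fun n => ?_
  rw [Equiv.coe_addRight, aux_t_succ hq, zpow_add_one₀ hz, mul_zpow]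
  ring

lemma aux_theta_shift {q z : ℂ} (hq : q ≠ 0) (hz : z ≠ 0) (n : ℤ) :
    thetaQ q z = q ^ (n * (n - 1) / 2) * z ^ n * thetaQ q (z * q ^ n) := by
  have step : ∀ m : ℤ, q ^ (m * (m - 1) / 2) * z ^ m * thetaQ q (z * q ^ m) =
      q ^ ((m + 1) * (m + 1 - 1) / 2) * z ^ (m + 1) * thetaQ q (z * q ^ (m + 1)) := by
    intro m
    rw [aux_t_succ hq, aux_theta_shift_one hq (mul_ne_zero hz (zpow_ne_zero m hq)),
      zpow_add_one₀ hz, zpow_add_one₀ hq, mul_assoc z]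
    ring
  induction n using Int.induction_on with
  | zero => simp
  | succ i ih => rw [← step]; exact ih
  | pred i ih =>
    have := step (-i - 1)
    rw [show (-(i : ℤ) - 1 + 1) = -i by ring] at this
    rw [this]; exact ih

lemma aux_exp_w {q lam : ℂ} (hq : q ≠ 0) (hlam : lam ≠ 0) (m : ℤ) (k : ℕ) :
    (q / (lam * q ^ (m + (k : ℤ)))) ^ k =
      (lam ^ k * q ^ (m * (k : ℤ)) * (q ^ ((k : ℤ) * (k - 1) / 2)) ^ 2)⁻¹ := by
  have hkk : (k : ℤ) * (k - 1) / 2 * 2 = k * (k - 1) :=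
    Int.ediv_mul_cancel (Int.even_mul_pred_self (k : ℤ)).two_dvd
  have h2 : (q ^ ((k : ℤ) * (k - 1) / 2)) ^ 2 = q ^ ((k : ℤ) * (k - 1)) := by
    conv_rhs => rw [← hkk, zpow_mul]
    exact (zpow_natCast _ 2).symm
  have h3 : q / (lam * q ^ (m + (k : ℤ))) = (lam * q ^ (m + (k : ℤ) - 1))⁻¹ := by
    rw [zpow_sub_one₀ hq]
    have := zpow_ne_zero (m + (k : ℤ)) hq
    field_simp
  rw [h2, h3, inv_pow, mul_pow, mul_assoc, ← zpow_add₀ hq, ← zpow_natCast (q ^ _) k, ← zpow_mul]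
  congr 3
  ring_nf

lemma aux_main {q lam z : ℂ} (hq : q ≠ 0) (hq1 : ‖q‖ < 1) (hlam : lam ≠ 0)
    (hz : z ≠ 0) (hz1 : ‖z‖ < 1) :
    HasSum (fun n : ℤ => q ^ (n * (n - 1) / 2) * (lam * z) ^ n *
        qPochInf q (-(q / (lam * q ^ n))))
      (thetaQ q (lam * z) * ∑' m : ℕ, z ^ m / auxP q m) := by
  have sf := aux_theta_summable hq hq1 (mul_ne_zero hlam hz)
  have sg := aux_phi_summable hq1 hz hz1
  have hp : HasSum (fun p : ℤ × ℕ => (q ^ (p.1 * (p.1 - 1) / 2) * (lam * z) ^ p.1) *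
      (z ^ p.2 / auxP q p.2)) (thetaQ q (lam * z) * ∑' m : ℕ, z ^ m / auxP q m) := by
    have hs := summable_mul_of_summable_norm sf.norm sg.norm
    have h := tsum_mul_tsum_of_summable_norm sf.norm sg.norm
    unfold thetaQ
    rw [h]
    exact hs.hasSum
  let e : ℤ × ℕ ≃ ℤ × ℕ :=
    { toFun := fun p => (p.1 - p.2, p.2)
      invFun := fun p => (p.1 + p.2, p.2)
      left_inv := fun p => by simp
      right_inv := fun p => by simp }
  have hp' := (e.hasSum_iff).2 hp
  refine hp'.prod_fiberwise fun n => ?_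
  have hw : q / (lam * q ^ n) ≠ 0 := div_ne_zero hq (mul_ne_zero hlam (zpow_ne_zero n hq))
  rw [← aux_euler hq hq1 hw]
  have hs : HasSum (fun k : ℕ => (q ^ (n * (n - 1) / 2) * (lam * z) ^ n) *
      (q ^ ((k : ℤ) * (k - 1) / 2) * (q / (lam * q ^ n)) ^ k / auxP q k))
      (q ^ (n * (n - 1) / 2) * (lam * z) ^ n * auxF q (q / (lam * q ^ n))) :=
    (aux_euler_summable hq hq1 hw).hasSum.mul_left _
  refine (congrArg (fun f => HasSum f _) (funext fun k => ?_)).mp hs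
  obtain ⟨m, rfl⟩ : ∃ m : ℤ, n = m + k := ⟨n - k, by ring⟩
  have he : e (m + k, k) = (m, k) := by simp [e]
  simp only [Function.comp_apply, he]
  have h1 := auxP_ne hq1 k
  rw [aux_t_add hq, aux_exp_w hq hlam m k, zpow_add₀ (mul_ne_zero hlam hz),
    zpow_natCast (lam * z) k, mul_pow lam z k]
  have hk := zpow_ne_zero ((k : ℤ) * (k - 1) / 2) hq
  have hl := pow_ne_zero k hlam
  have hmk := zpow_ne_zero (m * (k : ℤ)) hq
  field_simp

theorem stmt_7 (q a lam x : ℂ)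
    (hq0 : 0 < ‖q‖) (hq1 : ‖q‖ < 1)
    (ha : a ≠ 0) (haq : ∀ m : ℤ, a ≠ q ^ m)
    (hlam : lam ≠ 0) (hlq : ∀ m : ℤ, lam ≠ -(q ^ m))
    (hx : x ≠ 0) (hax : 1 < ‖a * x‖)
    (hxl : ∀ m : ℤ, x ≠ -(lam * q ^ m))
    (ψB : ℂ → ℂ)
    (hψB : ∀ ξ : ℂ, ψB ξ =
      (qPochInf q q / qPochInf q (q / a)) * (thetaQ q (a * ξ) / thetaQ q ξ) *
        qPochInf q (-(q / ξ))) :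
    HasSum (fun n : ℤ => ψB (lam * q ^ n) / thetaQ q (lam * q ^ n / x))
      ((qPochInf q q / qPochInf q (q / a)) *
        (thetaQ q (a * lam) * thetaQ q (a * q * x / lam) /
          (thetaQ q lam * thetaQ q (q * x / lam))) *
        ∑' m : ℕ, (1 / (a * x)) ^ m / qPochInt q q m) := by
  have hq : q ≠ 0 := norm_pos_iff.1 hq0
  have hz : 1 / (a * x) ≠ 0 := one_div_ne_zero (mul_ne_zero ha hx)
  have hz1 : ‖1 / (a * x)‖ < 1 := by
    rw [norm_div, norm_one, div_lt_one (by linarith)]; exact hax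
  have hm := (aux_main hq hq1 hlam hz hz1).mul_left
    ((qPochInf q q / qPochInf q (q / a)) * (thetaQ q (a * lam) /
      (thetaQ q lam * thetaQ q (lam / x))))
  have e1 : thetaQ q (q * x / lam) = thetaQ q (lam / x) := by
    rw [← aux_theta_inv hq (div_ne_zero hlam hx)]; congr 1; field_simp
  have e2 : thetaQ q (a * q * x / lam) = thetaQ q (lam * (1 / (a * x))) := by
    rw [← aux_theta_inv hq (mul_ne_zero hlam hz)]; congr 1; field_simp
  have e3 : ∀ m : ℕ, qPochInt q q m = auxP q m := fun m => by
    simp [qPochInt, auxP]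
  simp only [e1, e2, e3]
  convert hm using 1
  · rfl
  · funext n
    rw [hψB, aux_theta_shift hq (mul_ne_zero ha hlam) n, aux_theta_shift hq hlam n,
      aux_theta_shift hq (div_ne_zero hlam hx) n]
    rw [show a * (lam * q ^ n) = a * lam * q ^ n by ring,
      show lam * q ^ n / x = lam / x * q ^ n by ring]
    generalize thetaQ q (a * lam * q ^ n) = A
    generalize thetaQ q (lam * q ^ n) = B
    generalize thetaQ q (lam / x * q ^ n) = D
    generalize qPochInf q (-(q / (lam * q ^ n))) = E
    generalize qPochInf q q / qPochInf q (q / a) = C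
    have h1 := zpow_ne_zero (n * (n - 1) / 2) hq
    have h2 := zpow_ne_zero n hlam
    have h3 := zpow_ne_zero n ha
    have h4 := zpow_ne_zero n hx
    simp only [mul_zpow, div_zpow, one_zpow]
    generalize q ^ (n * (n - 1) / 2) = t at *
    generalize lam ^ n = L at *
    generalize a ^ n = a' at *
    generalize x ^ n = x' at *
    rcases eq_or_ne B 0 with rfl | hB
    · simp
    rcases eq_or_ne D 0 with rfl | hD
    · simp
    field_simp
  · ring
end

section
/- Let α, β be complex numbers and let z be a nonzero complex number with −π < arg z < π. Then, as q → 1−0 along real values in (0,1), the ratio θ_q(q^β z)/θ_q(q^α z) tends to z^{α−β} (principal branch). -/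
open Complex Filter Topology

lemma thetaQ_eq_jacobi (t : ℝ) (ht : 0 < t) (β z : ℂ) (hz : z ≠ 0) :
    thetaQ ((Real.exp (-t) : ℝ) : ℂ) (((Real.exp (-t) : ℝ) : ℂ) ^ β * z) =
      1 / ((t / (2 * Real.pi) : ℂ)) ^ (1 / 2 : ℂ) *
        cexp ((log z + t / 2 - β * t) ^ 2 / (2 * t)) *
        jacobiTheta₂ (-(log z / t + 1 / 2 - β)) (2 * Real.pi * I / t) := by
  have hpi : (Real.pi : ℂ) ≠ 0 := by exact_mod_cast Real.pi_ne_zero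
  have htc : (t : ℂ) ≠ 0 := by exact_mod_cast ht.ne'
  have hI : I ≠ 0 := I_ne_zero
  have h1 : thetaQ ((Real.exp (-t) : ℝ) : ℂ) (((Real.exp (-t) : ℝ) : ℂ) ^ β * z) =
      jacobiTheta₂ ((log z + t / 2 - β * t) / (2 * Real.pi * I)) (I * t / (2 * Real.pi)) := by
    unfold thetaQ jacobiTheta₂
    congr 1
    ext n
    unfold jacobiTheta₂_term
    have hq0 : ((Real.exp (-t) : ℝ) : ℂ) ≠ 0 := by exact_mod_cast (Real.exp_pos _).ne'
    have e1 : ((Real.exp (-t) : ℝ) : ℂ) ^ β = cexp (-t * β) := by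
      rw [cpow_def_of_ne_zero hq0, ← ofReal_log (Real.exp_pos _).le, Real.log_exp]
      push_cast
      rfl
    have e2 : ((Real.exp (-t) : ℝ) : ℂ) ^ β * z = cexp (-t * β + log z) := by
      rw [e1, exp_add, exp_log hz]
    rw [e2, ofReal_exp, ← exp_int_mul, ← exp_int_mul, ← exp_add]
    congr 1
    have h2 : ((n * (n - 1) / 2 : ℤ) : ℂ) = (n * (n - 1) : ℂ) / 2 := by
      rw [Int.cast_div]
      · push_cast; rfl
      · have := Int.even_mul_pred_self n
        exact this.two_dvd
      · norm_num
    rw [h2]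
    push_cast
    field_simp
    rw [I_sq]
    ring
  rw [h1, jacobiTheta₂_functional_equation]
  have a1 : -I * (I * t / (2 * Real.pi)) = (t / (2 * Real.pi) : ℂ) := by
    field_simp
    rw [I_sq]; ring
  have a2 : -Real.pi * I * ((log z + t / 2 - β * t) / (2 * Real.pi * I)) ^ 2
      / (I * t / (2 * Real.pi)) = (log z + t / 2 - β * t) ^ 2 / (2 * t) := by
    field_simp
    rw [I_sq]; ring
  have a3 : (log z + t / 2 - β * t) / (2 * Real.pi * I) / (I * t / (2 * Real.pi))
      = -(log z / t + 1 / 2 - β) := by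
    field_simp
    rw [I_sq]; ring
  have a4 : -1 / (I * t / (2 * Real.pi)) = 2 * Real.pi * I / t := by
    field_simp
    rw [I_sq]
  rw [a1, a2, a3, a4]

lemma tendsto_jacobi (β z : ℂ) (harg1 : -Real.pi < z.arg) (harg2 : z.arg < Real.pi) :
    Tendsto (fun t : ℝ => jacobiTheta₂ (-(log z / t + 1 / 2 - β)) (2 * Real.pi * I / t))
      (𝓝[>] 0) (𝓝 1) := by
  have hpi := Real.pi_pos
  set δ := Real.pi - |z.arg| with hδ
  have hδ0 : 0 < δ := by
    have : |z.arg| < Real.pi := abs_lt.2 ⟨harg1, harg2⟩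
    linarith
  have hnorm : ∀ t : ℝ, 0 < t → ∀ n : ℤ,
      ‖jacobiTheta₂_term n (-(log z / t + 1 / 2 - β)) (2 * Real.pi * I / t)‖ ≤
        Real.exp (-(2 * Real.pi * δ * (n : ℝ) ^ 2) * t⁻¹ + 2 * Real.pi * |β.im| * |(n : ℝ)|) := by
    intro t ht n
    rw [norm_jacobiTheta₂_term]
    apply Real.exp_le_exp.2
    have i1 : (2 * Real.pi * I / t : ℂ).im = 2 * Real.pi * t⁻¹ := by
      rw [div_ofReal_im]; simp [div_eq_mul_inv]
    have i2 : (-(log z / t + 1 / 2 - β)).im = -(z.arg * t⁻¹) + β.im := by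
      have j1 : (1 / 2 : ℂ).im = 0 := by simp
      rw [neg_im, sub_im, add_im, div_ofReal_im, log_im, j1, div_eq_mul_inv]
      ring
    rw [i1, i2]
    have hti : 0 < t⁻¹ := inv_pos.2 ht
    have b1 : (n : ℝ) * z.arg ≤ |z.arg| * (n : ℝ) ^ 2 := by
      have c1 : (n : ℝ) * z.arg ≤ |(n : ℝ)| * |z.arg| := by
        rw [← abs_mul]; exact le_abs_self _
      have c2 : |(n : ℝ)| ≤ (n : ℝ) ^ 2 := by
        rw [← sq_abs]
        have : (|n| : ℤ) ≤ |n| ^ 2 := Int.le_self_sq _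
        exact_mod_cast this
      nlinarith [abs_nonneg z.arg]
    have b2 : -((n : ℝ) * β.im) ≤ |β.im| * |(n : ℝ)| := by
      rw [mul_comm |β.im|, ← abs_mul]; exact neg_le_abs _
    have b3 := mul_le_mul_of_nonneg_left b1 (by positivity : 0 ≤ 2 * Real.pi * t⁻¹)
    have b4 := mul_le_mul_of_nonneg_left b2 (by positivity : 0 ≤ 2 * Real.pi)
    rw [hδ]
    nlinarith
  have key : Tendsto (fun t : ℝ => ∑' n : ℤ,
      jacobiTheta₂_term n (-(log z / t + 1 / 2 - β)) (2 * Real.pi * I / t))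
      (𝓝[>] 0) (𝓝 (∑' n : ℤ, if n = 0 then (1 : ℂ) else 0)) := by
    apply tendsto_tsum_of_dominated_convergence
      (bound := fun n : ℤ => Real.exp (-Real.pi * (2 * δ * (n : ℝ) ^ 2 - 2 * |β.im| * |(n : ℝ)|)))
    · have := summable_pow_mul_jacobiTheta₂_term_bound |β.im| (T := 2 * δ) (by positivity) 0
      simpa using this
    · intro n
      by_cases hn : n = 0
      · subst hn
        simp [jacobiTheta₂_term]
      · simp only [hn, if_false]
        apply squeeze_zero_norm' (a := fun t : ℝ => Real.exp
          (-(2 * Real.pi * δ * (n : ℝ) ^ 2) * t⁻¹ + 2 * Real.pi * |β.im| * |(n : ℝ)|))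
        · filter_upwards [self_mem_nhdsWithin] with t ht using hnorm t ht n
        · apply Real.tendsto_exp_atBot.comp
          apply tendsto_atBot_add_const_right
          apply Tendsto.const_mul_atTop_of_neg _ tendsto_inv_nhdsGT_zero
          have : (n : ℝ) ≠ 0 := by exact_mod_cast hn
          have : 0 < 2 * Real.pi * δ * (n : ℝ) ^ 2 := by positivity
          linarith
    · filter_upwards [Ioo_mem_nhdsGT (zero_lt_one' ℝ)] with t ht n
      refine (hnorm t ht.1 n).trans (Real.exp_le_exp.2 ?_)
      have h1 : 1 ≤ t⁻¹ := (one_le_inv₀ ht.1).2 ht.2.le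
      have := mul_le_mul_of_nonneg_left h1 (by positivity : 0 ≤ 2 * Real.pi * δ * (n : ℝ) ^ 2)
      nlinarith
  simpa [jacobiTheta₂] using key

theorem stmt_10 (α β : ℂ) (z : ℂ) (hz : z ≠ 0)
    (harg1 : -Real.pi < z.arg) (harg2 : z.arg < Real.pi) :
    Filter.Tendsto
      (fun q : ℝ => thetaQ (q : ℂ) ((q : ℂ) ^ β * z) / thetaQ (q : ℂ) ((q : ℂ) ^ α * z))
      (nhdsWithin 1 (Set.Ioo (0 : ℝ) 1))
      (nhds (z ^ (α - β))) := by
  have hlim : Tendsto (fun t : ℝ => cexp ((α - β) * (log z + t / 2 - (α + β) * t / 2)) *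
      (jacobiTheta₂ (-(log z / t + 1 / 2 - β)) (2 * Real.pi * I / t) /
       jacobiTheta₂ (-(log z / t + 1 / 2 - α)) (2 * Real.pi * I / t)))
      (𝓝[>] 0) (𝓝 (z ^ (α - β))) := by
    have h1 := (tendsto_jacobi β z harg1 harg2).div (tendsto_jacobi α z harg1 harg2) one_ne_zero
    have h2 : Tendsto (fun t : ℝ => cexp ((α - β) * (log z + t / 2 - (α + β) * t / 2)))
        (𝓝[>] 0) (𝓝 (z ^ (α - β))) := by
      have hc : Continuous
          (fun t : ℝ => cexp ((α - β) * (log z + t / 2 - (α + β) * t / 2))) := by fun_prop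
      have := (hc.tendsto 0).mono_left (nhdsWithin_le_nhds (s := Set.Ioi 0))
      convert this using 2
      rw [cpow_def_of_ne_zero hz]
      simp [mul_comm]
    simpa using h2.mul h1
  have hlog : Tendsto (fun q : ℝ => -Real.log q) (𝓝[Set.Ioo 0 1] 1) (𝓝[>] 0) := by
    apply tendsto_nhdsWithin_of_tendsto_nhds_of_eventually_within
    · have : Tendsto (fun q : ℝ => -Real.log q) (𝓝 1) (𝓝 (-Real.log 1)) :=
        (Real.continuousAt_log one_ne_zero).tendsto.neg
      rw [Real.log_one, neg_zero] at this
      exact this.mono_left nhdsWithin_le_nhds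
    · filter_upwards [self_mem_nhdsWithin] with q hq
      have := Real.log_neg hq.1 hq.2
      simpa using this
  refine (hlim.comp hlog).congr' ?_
  filter_upwards [self_mem_nhdsWithin] with q hq
  have hq' : Real.exp (-(-Real.log q)) = q := by rw [neg_neg, Real.exp_log hq.1]
  have ht : 0 < -Real.log q := by
    have := Real.log_neg hq.1 hq.2
    linarith
  simp only [Function.comp]
  generalize -Real.log q = t at *
  subst hq'
  rw [thetaQ_eq_jacobi t ht β z hz, thetaQ_eq_jacobi t ht α z hz]
  have htc : (t : ℂ) ≠ 0 := by exact_mod_cast ht.ne'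
  have hpi : (Real.pi : ℂ) ≠ 0 := by exact_mod_cast Real.pi_ne_zero
  have hc : 1 / ((t / (2 * Real.pi) : ℂ)) ^ (1 / 2 : ℂ) ≠ 0 := by
    apply one_div_ne_zero
    rw [cpow_ne_zero_iff]
    left
    exact div_ne_zero htc (by simp [hpi])
  rw [mul_div_mul_comm, mul_div_mul_left _ _ hc, ← exp_sub]
  congr 2
  field_simp
  ring
end

section
/- Let α, β be complex numbers and let z be a nonzero complex number with −π < arg z < π. Then, as q → 1−0 along real values in (0,1), the quantity (1−q)^{β−α} · θ_q( q^α z/(1−q) ) / θ_q( q^β z/(1−q) ) tends to z^{β−α} (principal branch). -/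
open Complex Filter Topology

lemma aux_tendsto {ι : Type*} (l : Filter ι) (M : ι → ℂ) (h : ι → ℝ) (a c : ℝ)
    (ha : |a| < Real.pi) (hpos : ∀ᶠ q in l, 0 < h q) (h0 : Tendsto h l (𝓝 0))
    (hM : ∀ᶠ q in l, (M q).im = a + h q * c) :
    Tendsto (fun q => jacobiTheta₂ (-(M q) / h q) (2 * Real.pi * I / h q)) l (𝓝 1) := by
  have hpi := Real.pi_pos
  set T : ℝ := 2 * (Real.pi - |a|) with hT
  have hTpos : 0 < T := by rw [hT]; linarith
  have hle : ∀ᶠ q in l, ∀ n : ℤ,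
      ‖jacobiTheta₂_term n (-(M q) / h q) (2 * Real.pi * I / h q)‖ ≤
        Real.exp (-Real.pi * (T * n ^ 2 / h q - 2 * |c| * |(n : ℝ)|)) := by
    filter_upwards [hpos, hM] with q hq hMq n
    rw [norm_jacobiTheta₂_term]
    have e1 : (-(M q) / h q).im = -(a / h q + c) := by
      rw [Complex.div_ofReal_im, neg_im, hMq]; field_simp
    have e2 : (2 * Real.pi * I / h q : ℂ).im = 2 * Real.pi / h q := by
      rw [Complex.div_ofReal_im]; simp
    rw [e1, e2]
    apply Real.exp_le_exp.mpr
    have hn : |(n : ℝ)| ≤ (n : ℝ) ^ 2 := by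
      have : |n| ≤ n ^ 2 := by
        rw [← sq_abs]; nlinarith [abs_nonneg n, sq_nonneg (|n| - 1), Int.le_self_sq |n|]
      exact_mod_cast this
    have h1 : a * n ≤ |a| * (n : ℝ) ^ 2 :=
      (le_abs_self _).trans (by rw [abs_mul]; exact mul_le_mul_of_nonneg_left hn (abs_nonneg a))
    have h2 : c * n ≤ |c| * |(n : ℝ)| := (le_abs_self _).trans (by rw [abs_mul])
    have h3 : a * n / h q ≤ |a| * (n : ℝ) ^ 2 / h q := by gcongr
    have h4 : Real.pi * (a * n / h q) ≤ Real.pi * (|a| * (n : ℝ) ^ 2 / h q) := by gcongr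
    have h5 : Real.pi * (c * n) ≤ Real.pi * (|c| * |(n : ℝ)|) := by gcongr
    have : -Real.pi * (T * n ^ 2 / h q - 2 * |c| * |(n : ℝ)|) -
      (-Real.pi * n ^ 2 * (2 * Real.pi / h q) - 2 * Real.pi * n * -(a / h q + c)) =
      2 * (Real.pi * (|a| * (n : ℝ) ^ 2 / h q) - Real.pi * (a * n / h q)) +
      2 * (Real.pi * (|c| * |(n : ℝ)|) - Real.pi * (c * n)) := by
        rw [hT]; ring
    linarith
  have key : Tendsto (fun q => ∑' n : ℤ, jacobiTheta₂_term n (-(M q) / h q)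
      (2 * Real.pi * I / h q)) l (𝓝 (∑' n : ℤ, if n = 0 then (1 : ℂ) else 0)) := by
    apply tendsto_tsum_of_dominated_convergence
      (bound := fun n : ℤ => Real.exp (-Real.pi * (T * n ^ 2 - 2 * |c| * |(n : ℝ)|)))
    · simpa using summable_pow_mul_jacobiTheta₂_term_bound |c| hTpos 0
    · intro n
      by_cases hn : n = 0
      · subst hn
        simpa [jacobiTheta₂_term] using (tendsto_const_nhds : Tendsto (fun _ : ι => (1 : ℂ)) l (𝓝 1))
      · rw [if_neg hn]
        apply squeeze_zero_norm' (hle.mono fun q hq => hq n)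
        apply Real.tendsto_exp_atBot.comp
        have hinv : Tendsto (fun q => (h q)⁻¹) l atTop := by
          apply tendsto_inv_nhdsGT_zero.comp
          exact tendsto_nhdsWithin_iff.mpr ⟨h0, hpos⟩
        have hK : 0 < Real.pi * (T * (n : ℝ) ^ 2) := by positivity
        have := tendsto_atBot_add_const_left l (Real.pi * (2 * |c| * |(n : ℝ)|))
          (tendsto_neg_atTop_atBot.comp (hinv.const_mul_atTop hK))
        refine this.congr fun q => ?_
        simp only [Function.comp]
        ring
    · have : ∀ᶠ q in l, h q < 1 := h0.eventually_lt_const one_pos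
      filter_upwards [hle, hpos, this] with q hq hp h1 n
      refine (hq n).trans (Real.exp_le_exp.mpr ?_)
      have : T * (n : ℝ) ^ 2 ≤ T * n ^ 2 / h q := by
        rw [le_div_iff₀ hp]
        have : 0 ≤ T * (n : ℝ) ^ 2 := by positivity
        nlinarith
      nlinarith
  rw [tsum_ite_eq] at key
  exact key

lemma thetaQ_eq (h : ℝ) (hh : 0 < h) (L : ℂ) :
    thetaQ (cexp (-h)) (cexp L) =
      1 / ((h / (2 * Real.pi) : ℂ)) ^ (1 / 2 : ℂ) * cexp ((h / 2 + L) ^ 2 / (2 * h)) *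
        jacobiTheta₂ (-(h / 2 + L) / h) (2 * Real.pi * I / h) := by
  have hpi : (Real.pi : ℂ) ≠ 0 := by exact_mod_cast Real.pi_ne_zero
  have hhc : (h : ℂ) ≠ 0 := by exact_mod_cast hh.ne'
  have e : thetaQ (cexp (-h)) (cexp L) =
      jacobiTheta₂ ((h / 2 + L) / (2 * Real.pi * I)) (I * h / (2 * Real.pi)) := by
    unfold thetaQ jacobiTheta₂ jacobiTheta₂_term
    congr 1
    ext n
    rw [← Complex.exp_int_mul, ← Complex.exp_int_mul, ← Complex.exp_add]
    congr 1
    have h2 : (((n * (n - 1) / 2 : ℤ)) : ℂ) * 2 = n * (n - 1) := by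
      have : (n * (n - 1) / 2) * 2 = n * (n - 1) :=
        Int.ediv_mul_cancel (by simpa using (Int.even_mul_pred_self n).two_dvd)
      exact_mod_cast this
    have h3 : (((n * (n - 1) / 2 : ℤ)) : ℂ) = n * (n - 1) / 2 := by
      rw [← h2]; ring
    rw [h3]
    field_simp
    rw [I_sq]
    ring
  rw [e, jacobiTheta₂_functional_equation]
  have e1 : -I * (I * h / (2 * Real.pi)) = (h / (2 * Real.pi) : ℂ) := by
    linear_combination (-(h:ℂ) / (2 * Real.pi)) * I_sq
  have e2 : -Real.pi * I * ((h / 2 + L) / (2 * Real.pi * I)) ^ 2 / (I * h / (2 * Real.pi)) =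
      (h / 2 + L) ^ 2 / (2 * h) := by
    field_simp
    rw [I_sq]
    ring
  have e3 : (h / 2 + L) / (2 * Real.pi * I) / (I * h / (2 * Real.pi)) = -(h / 2 + L) / h := by
    field_simp
    rw [I_sq]
    ring
  have e4 : -1 / (I * h / (2 * Real.pi)) = 2 * Real.pi * I / h := by
    field_simp
    rw [I_sq]
  rw [e1, e2, e3, e4]

theorem stmt_11 (α β : ℂ) (z : ℂ) (hz : z ≠ 0)
    (harg1 : -Real.pi < z.arg) (harg2 : z.arg < Real.pi) :
    Filter.Tendsto
      (fun q : ℝ =>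
        ((1 : ℂ) - q) ^ (β - α) *
          (thetaQ (q : ℂ) ((q : ℂ) ^ α * z / (1 - (q : ℂ))) /
            thetaQ (q : ℂ) ((q : ℂ) ^ β * z / (1 - (q : ℂ)))))
      (nhdsWithin 1 (Set.Ioo (0 : ℝ) 1))
      (nhds (z ^ (β - α))) := by
  have hpi := Real.pi_pos
  set l := nhdsWithin (1 : ℝ) (Set.Ioo (0 : ℝ) 1) with hl
  have hmem : ∀ᶠ q in l, q ∈ Set.Ioo (0 : ℝ) 1 := self_mem_nhdsWithin
  set h : ℝ → ℝ := fun q => -Real.log q with hh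
  set L : ℂ → ℝ → ℂ := fun γ q => -h q * γ + log z - Real.log (1 - q) with hL
  have hpos : ∀ᶠ q in l, 0 < h q := by
    filter_upwards [hmem] with q hq
    have := Real.log_neg hq.1 hq.2
    simp only [hh]; linarith
  have h0 : Tendsto h l (𝓝 0) := by
    have : Tendsto Real.log (𝓝 1) (𝓝 0) := by
      simpa using (Real.continuousAt_log one_ne_zero).tendsto
    have h3 := (this.mono_left (nhdsWithin_le_nhds : l ≤ 𝓝 1)).neg
    rw [neg_zero] at h3
    exact h3
  have hJ : ∀ γ : ℂ, Tendsto (fun q => jacobiTheta₂ (-(h q / 2 + L γ q) / h q)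
      (2 * Real.pi * I / h q)) l (𝓝 1) := by
    intro γ
    apply aux_tendsto l (fun q => h q / 2 + L γ q) h z.arg (-γ.im)
      (abs_lt.mpr ⟨harg1, harg2⟩) hpos h0
    refine Eventually.of_forall fun q => ?_
    have : (h q / 2 + L γ q) = ((h q / 2 - Real.log (1 - q) : ℝ) : ℂ) + log z - (h q : ℝ) * γ := by
      simp only [hL]; push_cast; ring
    rw [this, sub_im, add_im, ofReal_im, log_im, im_ofReal_mul]
    ring
  have hth : ∀ γ : ℂ, ∀ q ∈ Set.Ioo (0 : ℝ) 1,
      thetaQ (q : ℂ) ((q : ℂ) ^ γ * z / (1 - (q : ℂ))) =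
      thetaQ (cexp (-h q)) (cexp (L γ q)) := by
    intro γ q hq
    have hq0 : (q : ℂ) ≠ 0 := by exact_mod_cast hq.1.ne'
    have e1 : cexp (-h q) = q := by
      simp only [hh]
      rw [← ofReal_neg, ← ofReal_exp, neg_neg, Real.exp_log hq.1]
    have e2 : cexp (L γ q) = (q : ℂ) ^ γ * z / (1 - (q : ℂ)) := by
      have : L γ q = log q * γ + log z - Real.log (1 - q) := by
        simp only [hL, hh]
        rw [← ofReal_log hq.1.le]
        push_cast
        ring
      rw [this, exp_sub, exp_add, exp_log hz, cpow_def_of_ne_zero hq0, ← ofReal_exp,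
        Real.exp_log (by linarith [hq.2])]
      push_cast
      rfl
    rw [e1, e2]
  have hlim : Tendsto (fun q => cexp ((β - α) * (log z + h q * ((1 - α - β) / 2))) *
      (jacobiTheta₂ (-(h q / 2 + L α q) / h q) (2 * Real.pi * I / h q) /
       jacobiTheta₂ (-(h q / 2 + L β q) / h q) (2 * Real.pi * I / h q))) l
      (𝓝 (z ^ (β - α))) := by
    have hc : Tendsto (fun q => (h q : ℂ)) l (𝓝 0) := by
      have h3 := (continuous_ofReal.tendsto 0).comp h0
      rw [ofReal_zero] at h3
      exact h3
    have h1 : Tendsto (fun q => cexp ((β - α) * (log z + h q * ((1 - α - β) / 2)))) l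
        (𝓝 (cexp ((β - α) * (log z + 0 * ((1 - α - β) / 2))))) :=
      (continuous_exp.tendsto _).comp
        (((hc.mul_const _).const_add _).const_mul _)
    have h2 := h1.mul ((hJ α).div (hJ β) one_ne_zero)
    rw [cpow_def_of_ne_zero hz]
    have e : cexp (log z * (β - α)) =
        cexp ((β - α) * (log z + 0 * ((1 - α - β) / 2))) * (1 / 1) := by
      simp [mul_comm]
    rw [e]
    exact h2
  refine hlim.congr' ?_
  filter_upwards [hmem, hpos] with q hq hp
  rw [hth α q hq, hth β q hq, thetaQ_eq _ hp, thetaQ_eq _ hp]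
  have hhc : (h q : ℂ) ≠ 0 := by exact_mod_cast hp.ne'
  have hpc : (Real.pi : ℂ) ≠ 0 := by exact_mod_cast Real.pi_ne_zero
  have hA : (1 / ((h q / (2 * Real.pi) : ℂ)) ^ (1 / 2 : ℂ)) ≠ 0 := by
    apply one_div_ne_zero
    rw [cpow_def_of_ne_zero (div_ne_zero hhc (mul_ne_zero two_ne_zero hpc))]
    exact exp_ne_zero _
  have hq1 : (1 : ℂ) - q ≠ 0 := by
    have : (1 - q : ℝ) ≠ 0 := by linarith [hq.2]
    exact_mod_cast this
  have hlog : log ((1 : ℂ) - q) = Real.log (1 - q) := by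
    rw [ofReal_log (by linarith [hq.2])]; push_cast; rfl
  rw [cpow_def_of_ne_zero hq1, hlog, mul_div_mul_comm, mul_div_mul_comm, div_self hA, one_mul,
    ← exp_sub, ← mul_assoc, ← exp_add]
  congr 2
  simp only [hL]
  field_simp
  ring
end

section
/- Let q be a complex number with 0 < |q| < 1, let a be a nonzero complex number, and let x be a nonzero complex number with |ax| > 1/|q|, x ∉ {−q^m : m ∈ ℤ}, and ax ∉ {−q^m : m ∈ ℤ}. Define v̂(x) := (θ_q(ax)/θ_q(x)) · Σ_{n≥0} (ax)^{−n}/(q;q)_n. Then v̂ satisfies the first-order q-difference equation (1/q − ax) v̂(qx) + x v̂(x) = 0. -/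
open Complex Filter Topology

theorem theta_shift (q z : ℂ) (hq : q ≠ 0) (hz : z ≠ 0) : z * thetaQ q (q * z) = thetaQ q z := by
  unfold thetaQ
  rw [← tsum_mul_left, ← (Equiv.addRight (1 : ℤ)).tsum_eq (fun n : ℤ => q ^ (n * (n - 1) / 2) * z ^ n)]
  refine tsum_congr fun n => ?_
  have e : (n + 1) * (n + 1 - 1) / 2 = n * (n - 1) / 2 + n := by
    have : (n + 1) * (n + 1 - 1) = n * (n - 1) + n * 2 := by ring
    rw [this, Int.add_mul_ediv_right _ _ (by norm_num)]
  simp only [Equiv.coe_addRight]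
  rw [e, zpow_add₀ hq, zpow_add₀ hz, mul_zpow, zpow_one]
  ring

theorem poch_succ (q : ℂ) (n : ℕ) :
    qPochInt q q ((n + 1 : ℕ) : ℤ) = qPochInt q q (n : ℤ) * (1 - q ^ (n + 1)) := by
  have h1 : (0 : ℤ) ≤ ((n + 1 : ℕ) : ℤ) := Int.natCast_nonneg _
  have h2 : (0 : ℤ) ≤ (n : ℤ) := Int.natCast_nonneg _
  unfold qPochInt
  rw [if_pos h1, if_pos h2, Int.toNat_natCast, Int.toNat_natCast, Finset.prod_range_succ, pow_succ']

theorem one_sub_ne (q : ℂ) (hq1 : ‖q‖ < 1) (n : ℕ) : 1 - q ^ (n + 1) ≠ 0 := by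
  intro h
  have h1 : q ^ (n + 1) = 1 := (sub_eq_zero.mp h).symm
  have h2 : ‖q‖ ^ (n + 1) < 1 := pow_lt_one₀ (norm_nonneg _) hq1 (by omega)
  rw [← norm_pow, h1] at h2
  simp at h2

theorem poch_ne_s19 (q : ℂ) (hq1 : ‖q‖ < 1) (n : ℕ) : qPochInt q q (n : ℤ) ≠ 0 := by
  induction n with
  | zero => simp [qPochInt]
  | succ n ih => rw [poch_succ]; exact mul_ne_zero ih (one_sub_ne q hq1 n)

theorem F_summable (q u : ℂ) (hq1 : ‖q‖ < 1) (hu0 : u ≠ 0) (hu : ‖u‖ < 1) :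
    Summable (fun n : ℕ => u ^ n / qPochInt q q n) := by
  refine summable_of_ratio_test_tendsto_lt_one hu
    (Eventually.of_forall fun n => div_ne_zero (pow_ne_zero _ hu0) (poch_ne_s19 q hq1 n)) ?_
  have hr : ∀ n : ℕ, ‖u ^ (n + 1) / qPochInt q q ((n + 1 : ℕ) : ℤ)‖ / ‖u ^ n / qPochInt q q (n : ℤ)‖
      = ‖u / (1 - q ^ (n + 1))‖ := by
    intro n
    rw [← norm_div, poch_succ]
    have := poch_ne_s19 q hq1 n
    have := one_sub_ne q hq1 n
    congr 1
    field_simp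
    ring
  have ht : Tendsto (fun n : ℕ => ‖u / (1 - q ^ (n + 1))‖) atTop (𝓝 ‖u / (1 - 0)‖) := by
    refine (Tendsto.div tendsto_const_nhds (tendsto_const_nhds.sub ?_) (by simp)).norm
    exact (tendsto_pow_atTop_nhds_zero_of_norm_lt_one hq1).comp (tendsto_add_atTop_nat 1)
  rw [sub_zero, div_one] at ht
  exact ht.congr fun n => (hr n).symm

theorem F_shift (q u : ℂ) (hq0 : q ≠ 0) (hq1 : ‖q‖ < 1) (hu0 : u ≠ 0) (hu : ‖u‖ < 1) :
    (1 - u) * ∑' n : ℕ, u ^ n / qPochInt q q n = ∑' n : ℕ, (q * u) ^ n / qPochInt q q n := by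
  have hs := F_summable q u hq1 hu0 hu
  have hqu : ‖q * u‖ < 1 := by
    rw [norm_mul]; exact mul_lt_one_of_nonneg_of_lt_one_left (norm_nonneg _) hq1 hu.le
  have hs' := F_summable q (q * u) hq1 (mul_ne_zero hq0 hu0) hqu
  have key : ∑' n : ℕ, (u ^ n / qPochInt q q n - (q * u) ^ n / qPochInt q q n)
      = u * ∑' n : ℕ, u ^ n / qPochInt q q n := by
    rw [(hs.sub hs').tsum_eq_zero_add, ← tsum_mul_left]
    simp only [pow_zero, sub_self, zero_add]
    refine tsum_congr fun n => ?_
    rw [poch_succ]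
    have := poch_ne_s19 q hq1 n
    have := one_sub_ne q hq1 n
    rw [mul_pow]
    field_simp
    ring
  rw [hs.tsum_sub hs'] at key
  linear_combination key

theorem stmt_19 (q a x : ℂ)
    (hq0 : 0 < ‖q‖) (hq1 : ‖q‖ < 1)
    (ha : a ≠ 0) (hx : x ≠ 0)
    (hax : 1 / ‖q‖ < ‖a * x‖)
    (hxq : ∀ m : ℤ, x ≠ -(q ^ m))
    (haxq : ∀ m : ℤ, a * x ≠ -(q ^ m)) :
    (1 / q - a * x) *
        ((thetaQ q (a * (q * x)) / thetaQ q (q * x)) *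
          ∑' n : ℕ, (a * (q * x))⁻¹ ^ n / qPochInt q q n) +
      x * ((thetaQ q (a * x) / thetaQ q x) * ∑' n : ℕ, (a * x)⁻¹ ^ n / qPochInt q q n) = 0 := by
  have hq : q ≠ 0 := norm_pos_iff.mp hq0
  have hax0 : a * x ≠ 0 := mul_ne_zero ha hx
  have hu0 : (a * (q * x))⁻¹ ≠ 0 := inv_ne_zero (mul_ne_zero ha (mul_ne_zero hq hx))
  have hu : ‖(a * (q * x))⁻¹‖ < 1 := by
    rw [norm_inv]
    apply inv_lt_one_of_one_lt₀
    rw [div_lt_iff₀ hq0, ← norm_mul] at hax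
    rwa [show a * (q * x) = a * x * q by ring]
  have hF := F_shift q _ hq hq1 hu0 hu
  have e : q * (a * (q * x))⁻¹ = (a * x)⁻¹ := by field_simp
  rw [e] at hF
  rw [← hF, ← theta_shift q x hq hx, ← theta_shift q (a * x) hq hax0,
    show q * (a * x) = a * (q * x) by ring]
  generalize (∑' n : ℕ, (a * (q * x))⁻¹ ^ n / qPochInt q q n) = S
  generalize thetaQ q (a * (q * x)) = A
  by_cases hB : thetaQ q (q * x) = 0
  · simp [hB]
  generalize thetaQ q (q * x) = B at hB
  field_simp
  ring
end
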